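/- Let K be a language over E = E₁ ∪ … ∪ Eₙ (n ≥ 2) and let E_k satisfy ∪_{i≠j}(Eᵢ ∩ Eⱼ) ⊆ E_k ⊆ E. Then K is conditionally decomposable with respect to E₁, …, Eₙ and E_k if and only if for every i = 1, …, n: P_{i+k}(K) ∥ P_{1+2+…+(i−1)+(i+1)+…+n+k}(K) ⊆ K, where P_{1+2+…+(i−1)+(i+1)+…+n+k} denotes the natural projection from E* onto ((∪_{j≠i} Eⱼ) ∪ E_k)*. -/

import Mathlib

/- Language-theoretic model of discrete-event systems:
   strings over a finite alphabet (a `Finset` of symbols) are lists,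
   natural projections erase letters outside the target alphabet,
   and the parallel composition is the standard synchronous composition. -/

namespace DES

variable {A : Type} [DecidableEq A]

/-- `star E` is `E*`: the set of finite strings over the alphabet `E`. -/
def star (E : Finset A) : Set (List A) :=
  {w | ∀ a ∈ w, a ∈ E}

/-- The natural projection onto `E₀`: it keeps letters of `E₀` and erases all
other letters. -/
def proj (E₀ : Finset A) (w : List A) : List A :=
  w.filter (· ∈ E₀)

/-- The inverse image `P⁻¹(L) = { s ∈ E* : P(s) ∈ L }` of the natural projection
from `E*` onto `E₀*`. -/
def invProj (E E₀ : Finset A) (L : Set (List A)) : Set (List A) :=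
  {s | s ∈ star E ∧ proj E₀ s ∈ L}

/-- Parallel composition `L₁ ∥ L₂ = P₁⁻¹(L₁) ∩ P₂⁻¹(L₂) ⊆ (E₁ ∪ E₂)*` of
`L₁ ⊆ E₁*` and `L₂ ⊆ E₂*`. -/
def par (E₁ E₂ : Finset A) (L₁ L₂ : Set (List A)) : Set (List A) :=
  invProj (E₁ ∪ E₂) E₁ L₁ ∩ invProj (E₁ ∪ E₂) E₂ L₂

/-- Parallel composition of a finite family `L i ⊆ (E i)*`. -/
def parFam {ι : Type} [Fintype ι] (E : ι → Finset A) (L : ι → Set (List A)) :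
    Set (List A) :=
  {w | w ∈ star (Finset.univ.sup E) ∧ ∀ i, proj (E i) w ∈ L i}

/-- The prefix closure of a language. -/
def pref (L : Set (List A)) : Set (List A) :=
  {w | ∃ u, w ++ u ∈ L}

/-- `K` is conditionally decomposable w.r.t. the alphabets `E i` and `Ek`:
`K = P_{1+k}(K) ∥ ⋯ ∥ P_{n+k}(K)`. -/
def condDecomp {ι : Type} [Fintype ι] (E : ι → Finset A) (Ek : Finset A)
    (K : Set (List A)) : Prop :=
  K = parFam (fun i => E i ∪ Ek) (fun i => proj (E i ∪ Ek) '' K)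

/-- Conditional decomposability for two components:
`K = P_{1+k}(K) ∥ P_{2+k}(K)`. -/
def condDecomp2 (E₁ E₂ Ek : Finset A) (K : Set (List A)) : Prop :=
  K = par (E₁ ∪ Ek) (E₂ ∪ Ek) (proj (E₁ ∪ Ek) '' K) (proj (E₂ ∪ Ek) '' K)

/-- The natural projection from `E'*` onto `E₀*` is an `L`-observer. -/
def observer (E' E₀ : Finset A) (L : Set (List A)) : Prop :=
  ∀ t ∈ proj E₀ '' L, ∀ s ∈ pref L, proj E₀ s <+: t →
    ∃ u ∈ star E', s ++ u ∈ L ∧ proj E₀ (s ++ u) = t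

/-- Letter-to-letter renaming map: letters in `Ekeep` are kept, all other
letters are renamed by `g`. -/
def ren (Ekeep : Finset A) (g : A → A) (w : List A) : List A :=
  w.map (fun a => if a ∈ Ekeep then a else g a)


theorem proj_proj_of_subset {E F : Finset A} (h : E ⊆ F) (w : List A) :
    proj E (proj F w) = proj E w := by
  simp only [proj, List.filter_filter]
  refine List.filter_congr fun a _ => ?_
  by_cases ha : a ∈ E
  · simp [ha, h ha]
  · simp [ha]

theorem proj_congr_of_subset {E F : Finset A} (h : E ⊆ F) {v w : List A}
    (hvw : proj F v = proj F w) : proj E v = proj E w := by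
  rw [← proj_proj_of_subset h, hvw, proj_proj_of_subset h]

theorem proj_eq_self {E : Finset A} {w : List A} (h : w ∈ star E) : proj E w = w :=
  List.filter_eq_self.2 fun a ha => by simpa using h a ha

theorem proj_mem_star (E : Finset A) (w : List A) : proj E w ∈ star E := fun a ha => by
  simpa using (List.mem_filter.1 ha).2

/-- Two strings that agree on their common letters have a common interleaving. -/
theorem exists_interleaving {E F : Finset A} {s t : List A} (hs : s ∈ star E)
    (ht : t ∈ star F) (hst : proj F s = proj E t) :
    ∃ x ∈ star (E ∪ F), proj E x = s ∧ proj F x = t := by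
  induction s generalizing t with
  | nil =>
    exact ⟨t, fun a ha => Finset.mem_union_right _ (ht a ha), hst.symm, proj_eq_self ht⟩
  | cons a s ih =>
    have haE : a ∈ E := hs a (by simp)
    have hs' : s ∈ star E := fun b hb => hs b (by simp [hb])
    by_cases haF : a ∈ F
    · have h : List.filter (· ∈ E) t = a :: proj F s := by
        rw [show List.filter (· ∈ E) t = proj E t from rfl, ← hst]
        simp [proj, haF]
      obtain ⟨t₁, t₂, rfl, h₁, -, h₂⟩ := List.filter_eq_cons_iff.1 h
      obtain ⟨x, hx, hxE, hxF⟩ :=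
        ih hs' (t := t₂) (fun b hb => ht b (by simp [hb])) h₂.symm
      have ht₁ : t₁ ∈ star F := fun b hb => ht b (by simp [hb])
      have h₁E : proj E t₁ = [] := List.filter_eq_nil_iff.2 h₁
      have h₁F : proj F t₁ = t₁ := proj_eq_self ht₁
      refine ⟨t₁ ++ a :: x, ?_, ?_, ?_⟩
      · intro b hb
        rcases List.mem_append.1 hb with hb | hb
        · exact Finset.mem_union_right _ (ht₁ b hb)
        · rcases List.mem_cons.1 hb with rfl | hb
          · exact Finset.mem_union_left _ haE
          · exact hx b hb
      · simp only [proj] at *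
        simp [List.filter_append, h₁E, haE, hxE]
      · simp only [proj] at *
        rw [List.filter_append, h₁F, List.filter_cons_of_pos (by simpa using haF), hxF]
    · obtain ⟨x, hx, hxE, hxF⟩ := ih hs' ht (by simpa [proj, haF] using hst)
      refine ⟨a :: x, ?_, ?_, ?_⟩
      · intro b hb
        rcases List.mem_cons.1 hb with rfl | hb
        · exact Finset.mem_union_left _ haE
        · exact hx b hb
      · simp only [proj] at *
        simp [haE, hxE]
      · simp only [proj] at *
        simp [haF, hxF]

/-- Two strings that agree on `E ∩ F` can be merged into one that looks like the first
on `E` and like the second on `F`. -/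
theorem exists_merge {E F : Finset A} {s t : List A}
    (hst : proj (E ∩ F) s = proj (E ∩ F) t) :
    ∃ x ∈ star (E ∪ F), proj E x = proj E s ∧ proj F x = proj F t := by
  refine exists_interleaving (proj_mem_star E s) (proj_mem_star F t) ?_
  have h₁ : proj F (proj E s) = proj (E ∩ F) s := by
    simp only [proj, List.filter_filter]
    exact List.filter_congr fun a _ => by simp [Bool.and_comm]
  have h₂ : proj E (proj F t) = proj (E ∩ F) t := by
    simp only [proj, List.filter_filter]
    exact List.filter_congr fun a _ => by simp
  rw [h₁, h₂, hst]

theorem star_mono {B : Type} {E F : Finset B} (h : E ⊆ F) : star E ⊆ star F :=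
  fun _ hw a ha => h (hw a ha)

/-- `K` is conditionally decomposable w.r.t. `E₁, …, Eₙ, E_k`
iff, for every `i`, `P_{i+k}(K) ∥ P_{1+⋯+(i−1)+(i+1)+⋯+n+k}(K) ⊆ K`. -/
theorem stmt7 {A : Type} [DecidableEq A] {n : ℕ} (hn : 2 ≤ n)
    (E : Fin n → Finset A) (Ek : Finset A)
    (hs : ∀ i j, i ≠ j → E i ∩ E j ⊆ Ek)
    (hkE : Ek ⊆ Finset.univ.sup E)
    (K : Set (List A)) (hK : K ⊆ star (Finset.univ.sup E)) :
    condDecomp E Ek K ↔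
      ∀ i, par (E i ∪ Ek) ((Finset.univ.erase i).sup E ∪ Ek)
          (proj (E i ∪ Ek) '' K)
          (proj ((Finset.univ.erase i).sup E ∪ Ek) '' K) ⊆ K := by
  have hle : ∀ i, E i ⊆ Finset.univ.sup E := fun i =>
    Finset.le_sup (f := E) (Finset.mem_univ i)
  have hsup : Finset.univ.sup (fun i => E i ∪ Ek) ⊆ Finset.univ.sup E :=
    Finset.sup_le fun i _ => Finset.union_subset (hle i) hkE
  have hsup' : Finset.univ.sup E ⊆ Finset.univ.sup (fun i => E i ∪ Ek) :=
    Finset.sup_mono_fun fun i _ => Finset.subset_union_left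
  constructor
  · intro h i w hw
    rw [h]
    obtain ⟨⟨hwE, hwi⟩, -, v, hv, hvw⟩ := hw
    refine ⟨star_mono ?_ hwE, fun j => ?_⟩
    · exact (Finset.union_subset (Finset.union_subset (hle i) hkE)
        (Finset.union_subset (Finset.sup_mono (Finset.erase_subset _ _)) hkE)).trans hsup'
    · by_cases hj : j = i
      · exact hj ▸ hwi
      · refine ⟨v, hv, proj_congr_of_subset (Finset.union_subset_union_left ?_) hvw⟩
        exact Finset.le_sup (f := E) (Finset.mem_erase.2 ⟨hj, Finset.mem_univ j⟩)
  · intro h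
    refine Set.Subset.antisymm
      (fun w hw => ⟨star_mono hsup' (hK hw), fun i => ⟨w, hw, rfl⟩⟩) ?_
    rintro w ⟨hwE, hw⟩
    have key : ∀ S : Finset (Fin n),
        ∃ v ∈ K, proj (S.sup E ∪ Ek) v = proj (S.sup E ∪ Ek) w := by
      intro S
      induction S using Finset.induction_on with
      | empty =>
        obtain ⟨u, hu, huw⟩ := hw ⟨0, by omega⟩
        exact ⟨u, hu, proj_congr_of_subset (by simp) huw⟩
      | insert i S hi ih =>
        obtain ⟨v, hv, hvw⟩ := ih
        set F := (Finset.univ.erase i).sup E ∪ Ek with hF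
        have hinter : ((insert i S).sup E ∪ Ek) ∩ F ⊆ S.sup E ∪ Ek := by
          intro a ha
          simp only [hF, Finset.mem_inter, Finset.mem_union, Finset.mem_sup,
            Finset.mem_insert, Finset.mem_erase] at ha ⊢
          obtain ⟨⟨j, rfl | hj, haj⟩ | hak, h₂⟩ := ha
          · obtain ⟨l, ⟨hl, -⟩, hal⟩ | hak := h₂
            · exact Or.inr (hs j l hl.symm (Finset.mem_inter.2 ⟨haj, hal⟩))
            · exact Or.inr hak
          · exact Or.inl ⟨j, hj, haj⟩
          · exact Or.inr hak
        obtain ⟨x, hx, hxw, hxv⟩ := exists_merge (proj_congr_of_subset hinter hvw.symm)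
        have hi' : E i ∪ Ek ⊆ (insert i S).sup E ∪ Ek :=
          Finset.union_subset_union_left
            (Finset.le_sup (f := E) (Finset.mem_insert_self i S))
        have hcover : ((insert i S).sup E ∪ Ek) ∪ F ⊆ (E i ∪ Ek) ∪ F := by
          refine Finset.union_subset (Finset.union_subset (Finset.sup_le fun j _ => ?_) ?_)
            Finset.subset_union_right
          · by_cases hj : j = i
            · subst hj
              exact Finset.subset_union_left.trans Finset.subset_union_left
            · exact ((Finset.le_sup (f := E)
                (Finset.mem_erase.2 ⟨hj, Finset.mem_univ j⟩)).trans
                Finset.subset_union_left).trans Finset.subset_union_right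
          · exact Finset.subset_union_right.trans Finset.subset_union_left
        have hx' := star_mono hcover hx
        refine ⟨x, h i ⟨⟨hx', ?_⟩, hx', v, hv, hxv.symm⟩, hxw⟩
        rw [proj_congr_of_subset hi' hxw]
        exact hw i
    obtain ⟨v, hv, hvw⟩ := key Finset.univ
    rw [Finset.union_eq_left.2 hkE, proj_eq_self (hK hv),
      proj_eq_self (star_mono hsup hwE)] at hvw
    exact hvw ▸ hv

end DES
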